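/- Let γ : I → ℝ² be a smooth curve on an open interval I satisfying the 7/2-cusp conditions at c ∈ I with constants (k, l). Let Φ : ℝ² → ℝ² be a smooth map whose differential (Jacobian matrix) at γ(c) is invertible. Then the curve Γ := Φ ∘ γ satisfies the 7/2-cusp conditions at c with the same constants (k, l). -/

import Mathlib

noncomputable section

open Real

/-- Determinant of the 2×2 matrix with columns `a`, `b`. -/
def det2 (a b : ℝ × ℝ) : ℝ := a.1 * b.2 - a.2 * b.1

/-- `Φ : W → W'` is a smooth diffeomorphism with smooth inverse `Φinv`. -/
def SmoothDiffeoOn2 (Φ Φinv : ℝ × ℝ → ℝ × ℝ) (W W' : Set (ℝ × ℝ)) : Prop :=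
  ContDiffOn ℝ (⊤ : ℕ∞) Φ W ∧ ContDiffOn ℝ (⊤ : ℕ∞) Φinv W' ∧ Set.MapsTo Φ W W' ∧
    Set.MapsTo Φinv W' W ∧ (∀ p ∈ W, Φinv (Φ p) = p) ∧ (∀ p ∈ W', Φ (Φinv p) = p)

/-- `γ` is `𝒜`-equivalent at `c` to the curve `t ↦ (t^p, t^q)`: there are an open interval
`(a,b) ∋ 0`, a smooth `φ` on `(a,b)` with `φ(0) = c` and nowhere vanishing derivative, open
sets `W ∋ γ(c)`, `W' ∋ 0`, and a smooth diffeomorphism `Φ : W → W'` with `Φ(γ(c)) = 0`,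
such that `Φ(γ(φ(t))) = (t^p, t^q)` whenever `t ∈ (a,b)` and `γ(φ(t)) ∈ W`. -/
def AEquivCurveAt (γ : ℝ → ℝ × ℝ) (c : ℝ) (p q : ℕ) : Prop :=
  ∃ (a b : ℝ) (φ : ℝ → ℝ) (W W' : Set (ℝ × ℝ)) (Φ Φinv : ℝ × ℝ → ℝ × ℝ),
    a < 0 ∧ 0 < b ∧
    ContDiffOn ℝ (⊤ : ℕ∞) φ (Set.Ioo a b) ∧ φ 0 = c ∧ (∀ t ∈ Set.Ioo a b, deriv φ t ≠ 0) ∧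
    IsOpen W ∧ IsOpen W' ∧ γ c ∈ W ∧ ((0, 0) : ℝ × ℝ) ∈ W' ∧
    SmoothDiffeoOn2 Φ Φinv W W' ∧ Φ (γ c) = (0, 0) ∧
    (∀ t ∈ Set.Ioo a b, γ (φ t) ∈ W → Φ (γ (φ t)) = (t ^ p, t ^ q))

/-- `γ` satisfies the 7/2-cusp conditions at `c` with constants `(k, l)`:
`γ'(c) = 0`, `γ''(c) ≠ 0`, `γ'''(c) = k γ''(c)`, `γ⁽⁵⁾(c) − (10/3)k γ⁽⁴⁾(c) = l γ''(c)`,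
and `det(γ''(c), γ⁽⁷⁾(c) − 7k γ⁽⁶⁾(c) − (7l − (70/3)k³) γ⁽⁴⁾(c)) ≠ 0`. -/
def SevenHalfCuspCond (γ : ℝ → ℝ × ℝ) (c k l : ℝ) : Prop :=
  deriv γ c = 0 ∧ iteratedDeriv 2 γ c ≠ 0 ∧
  iteratedDeriv 3 γ c = k • iteratedDeriv 2 γ c ∧
  iteratedDeriv 5 γ c - ((10 / 3 : ℝ) * k) • iteratedDeriv 4 γ c
    = l • iteratedDeriv 2 γ c ∧
  det2 (iteratedDeriv 2 γ c)
    (iteratedDeriv 7 γ c - (7 * k) • iteratedDeriv 6 γ c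
      - (7 * l - (70 / 3 : ℝ) * k ^ 3) • iteratedDeriv 4 γ c) ≠ 0

theorem contDiffAt_deriv_aux {E : Type*} [NormedAddCommGroup E] [NormedSpace ℝ E]
    {x : ℝ} {f : ℝ → E} (hf : ContDiffAt ℝ (⊤ : ℕ∞) f x) :
    ContDiffAt ℝ (⊤ : ℕ∞) (deriv f) x := by
  have h : ContDiffAt ℝ (⊤ : ℕ∞) (fun y => fderiv ℝ f y 1) x :=
    (hf.fderiv_right (m := (⊤ : ℕ∞)) (by norm_cast)).clm_apply contDiffAt_const
  exact h

open Filter Topology in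
theorem leibniz_clm_aux {E F : Type*} [NormedAddCommGroup E] [NormedSpace ℝ E]
    [NormedAddCommGroup F] [NormedSpace ℝ F] (n : ℕ) {x : ℝ} {f : ℝ → E →L[ℝ] F} {g : ℝ → E}
    (hf : ContDiffAt ℝ (⊤ : ℕ∞) f x) (hg : ContDiffAt ℝ (⊤ : ℕ∞) g x) :
    iteratedDeriv n (fun t => f t (g t)) x = ∑ i ∈ Finset.range (n + 1),
      n.choose i • (iteratedDeriv i f x) (iteratedDeriv (n - i) g x) := by
  induction n generalizing f g with
  | zero => simp
  | succ n IH =>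
    have hf1 : ContDiffAt ℝ (⊤ : ℕ∞) (deriv f) x := contDiffAt_deriv_aux hf
    have hg1 : ContDiffAt ℝ (⊤ : ℕ∞) (deriv g) x := contDiffAt_deriv_aux hg
    have hev : deriv (fun t => f t (g t)) =ᶠ[𝓝 x]
        ((fun t => f t (deriv g t)) + (fun t => deriv f t (g t))) := by
      filter_upwards [(hf.of_le (m := 1) (by norm_cast)).eventually (by simp),
        (hg.of_le (m := 1) (by norm_cast)).eventually (by simp)] with y hfy hgy
      have h := (hfy.differentiableAt (by simp)).hasDerivAt.clm_apply
        (hgy.differentiableAt (by simp)).hasDerivAt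
      rw [h.deriv, Pi.add_apply, add_comm]
    rw [iteratedDeriv_succ', hev.iteratedDeriv_eq,
      iteratedDeriv_add ((hf.clm_apply hg1).of_le (by norm_cast; exact le_top))
        ((hf1.clm_apply hg).of_le (by norm_cast; exact le_top)),
      IH hf hg1, IH hf1 hg, Finset.sum_range_succ', Finset.sum_range_succ' _ (n + 1)]
    simp only [Nat.choose_succ_succ', add_smul, Finset.sum_add_distrib]
    nth_rw 3 [Finset.sum_range_succ]
    have : ∀ i ∈ Finset.range n, 1 ≤ n - i := by simp; lia
    simp +contextual [← iteratedDeriv_succ', ← n.sub_sub, Nat.sub_add_cancel, this]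
    abel

open Filter Topology in
theorem comp_succ_aux {E F : Type*} [NormedAddCommGroup E] [NormedSpace ℝ E]
    [NormedAddCommGroup F] [NormedSpace ℝ F] (n : ℕ) {x : ℝ} {G : E → F} {g : ℝ → E}
    (hG : ContDiff ℝ (⊤ : ℕ∞) G) (hg : ContDiffAt ℝ (⊤ : ℕ∞) g x) :
    iteratedDeriv (n + 1) (fun t => G (g t)) x = ∑ i ∈ Finset.range (n + 1),
      n.choose i • (iteratedDeriv i (fun t => fderiv ℝ G (g t)) x)
        (iteratedDeriv (n - i + 1) g x) := by
  have hg1 : ContDiffAt ℝ (⊤ : ℕ∞) (deriv g) x := contDiffAt_deriv_aux hg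
  have hG1 : ContDiff ℝ (⊤ : ℕ∞) (fderiv ℝ G) := hG.fderiv_right (by norm_cast)
  have hev : deriv (fun t => G (g t)) =ᶠ[𝓝 x] (fun t => fderiv ℝ G (g t) (deriv g t)) := by
    filter_upwards [(hg.of_le (m := 1) (by norm_cast)).eventually (by simp)]
      with y hgy
    exact ((hG.differentiable (by simp) (g y)).hasFDerivAt.comp_hasDerivAt y
      (hgy.differentiableAt (by simp)).hasDerivAt).deriv
  rw [iteratedDeriv_succ', hev.iteratedDeriv_eq,
    leibniz_clm_aux n (f := fun t => fderiv ℝ G (g t)) (hG1.contDiffAt.comp x hg) hg1]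
  simp only [← iteratedDeriv_succ']

theorem det2_map_aux (D : (ℝ × ℝ) →ₗ[ℝ] ℝ × ℝ) (a b : ℝ × ℝ) :
    det2 (D a) (D b) = LinearMap.det D * det2 a b := by
  have hD : ∀ p : ℝ × ℝ, D p = p.1 • D (1, 0) + p.2 • D (0, 1) := by
    intro p
    rw [← map_smul, ← map_smul, ← map_add]
    simp
  rw [hD a, hD b, ← LinearMap.det_toMatrix (Module.Basis.finTwoProd ℝ), Matrix.det_fin_two]
  simp [LinearMap.toMatrix_apply, det2]
  ring

/-- Invariance of the 7/2-cusp conditions under diffeomorphisms of the target: if `γ`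
satisfies the 7/2-cusp conditions at `c` with constants `(k, l)` and `Φ : ℝ² → ℝ²` is a
smooth map whose differential at `γ(c)` is invertible, then `Φ ∘ γ` satisfies the
7/2-cusp conditions at `c` with the same constants `(k, l)`. -/
theorem stmt16 (I : Set ℝ) (hIo : IsOpen I) (hIc : Convex ℝ I)
    (γ : ℝ → ℝ × ℝ) (hγ : ContDiffOn ℝ (⊤ : ℕ∞) γ I) (c : ℝ) (hcI : c ∈ I)
    (k l : ℝ) (hcond : SevenHalfCuspCond γ c k l)
    (Φ : ℝ × ℝ → ℝ × ℝ) (hΦ : ContDiff ℝ (⊤ : ℕ∞) Φ)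
    (hJac : LinearMap.det ((fderiv ℝ Φ (γ c)) : (ℝ × ℝ) →ₗ[ℝ] ℝ × ℝ) ≠ 0) :
    SevenHalfCuspCond (Φ ∘ γ) c k l := by
  obtain ⟨h1, h2, h3, h5, h7⟩ := hcond
  have hg : ContDiffAt ℝ (⊤ : ℕ∞) γ c := hγ.contDiffAt (hIo.mem_nhds hcI)
  have hΦ1 : ContDiff ℝ (⊤ : ℕ∞) (fderiv ℝ Φ) := hΦ.fderiv_right (by norm_cast)
  have hΦ2 : ContDiff ℝ (⊤ : ℕ∞) (fderiv ℝ (fderiv ℝ Φ)) := hΦ1.fderiv_right (by norm_cast)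
  have hsym : ∀ u v, fderiv ℝ (fderiv ℝ Φ) (γ c) u v = fderiv ℝ (fderiv ℝ Φ) (γ c) v u := by
    have := (hΦ.contDiffAt (x := γ c)).isSymmSndFDerivAt
      (by simp only [minSmoothness_of_isRCLikeNormedField]; norm_cast)
    exact fun u v => this u v
  have h1' : iteratedDeriv 1 γ c = 0 := by rw [iteratedDeriv_one]; exact h1
  have c1 := comp_succ_aux 0 hΦ2 hg
  have b1 := comp_succ_aux 0 hΦ1 hg
  have b2 := comp_succ_aux 1 hΦ1 hg
  have b3 := comp_succ_aux 2 hΦ1 hg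
  have b4 := comp_succ_aux 3 hΦ1 hg
  have b5 := comp_succ_aux 4 hΦ1 hg
  have e1 := comp_succ_aux 1 hΦ2 hg
  have e2 := comp_succ_aux 2 hΦ2 hg
  have a1 := comp_succ_aux 0 hΦ hg
  have a2 := comp_succ_aux 1 hΦ hg
  have a3 := comp_succ_aux 2 hΦ hg
  have a4 := comp_succ_aux 3 hΦ hg
  have a5 := comp_succ_aux 4 hΦ hg
  have a6 := comp_succ_aux 5 hΦ hg
  have a7 := comp_succ_aux 6 hΦ hg
  have f1 := comp_succ_aux 0 (hΦ2.fderiv_right (m := (⊤ : ℕ∞)) (by norm_cast)) hg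
  have n2 : Nat.choose 4 2 = 6 := rfl
  have n3 : Nat.choose 5 2 = 10 := rfl
  have n4 : Nat.choose 5 3 = 10 := rfl
  have n5 : Nat.choose 6 2 = 15 := rfl
  have n6 : Nat.choose 6 3 = 20 := rfl
  have n7 : Nat.choose 6 4 = 15 := rfl
  have n8 : Nat.choose 4 3 = 4 := rfl
  have n9 : Nat.choose 5 4 = 5 := rfl
  have n10 : Nat.choose 6 5 = 6 := rfl
  have n11 : Nat.choose 3 2 = 3 := rfl
  simp only [Finset.sum_range_succ, Finset.sum_range_zero, Nat.choose_zero_right, one_smul,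
    Nat.choose_self, Nat.choose_one_right, n2, n3, n4, n5, n6, n7, n8, n9, n10, n11, zero_add,
    Nat.reduceAdd, Nat.reduceSub, h1', map_zero, smul_zero, add_zero, iteratedDeriv_zero]
    at a1 a2 a3 a4 a5 a6 a7 b1 b2 b3 b4 b5 c1 e1 e2 f1
  simp only [f1, zero_apply, smul_zero, add_zero] at e1 e2
  simp only [b1, c1, e1, e2, zero_apply, smul_zero, add_zero] at b2 b3 b4 b5
  simp only [b1, b2, b3, b4, b5, zero_apply, add_apply,
    smul_apply, smul_zero, add_zero] at a2 a3 a4 a5 a6 a7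
  have h5' : iteratedDeriv 5 γ c = ((10 / 3 : ℝ) * k) • iteratedDeriv 4 γ c
      + l • iteratedDeriv 2 γ c := by rw [← h5]; abel
  have hfun : Φ ∘ γ = fun t => Φ (γ t) := rfl
  have key : iteratedDeriv 7 (Φ ∘ γ) c - (7 * k) • iteratedDeriv 6 (Φ ∘ γ) c
      - (7 * l - (70 / 3 : ℝ) * k ^ 3) • iteratedDeriv 4 (Φ ∘ γ) c
      = fderiv ℝ Φ (γ c) (iteratedDeriv 7 γ c - (7 * k) • iteratedDeriv 6 γ c
      - (7 * l - (70 / 3 : ℝ) * k ^ 3) • iteratedDeriv 4 γ c) := by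
    rw [hfun, a7, a6, a4, h5', h3, hsym (iteratedDeriv 4 γ c) (iteratedDeriv 2 γ c)]
    simp only [map_sub, map_add, map_smul, add_apply,
      smul_apply, hsym (iteratedDeriv 4 γ c) (iteratedDeriv 2 γ c)]
    module
  have hdet : det2 (iteratedDeriv 2 (Φ ∘ γ) c)
    (iteratedDeriv 7 (Φ ∘ γ) c - (7 * k) • iteratedDeriv 6 (Φ ∘ γ) c
      - (7 * l - (70 / 3 : ℝ) * k ^ 3) • iteratedDeriv 4 (Φ ∘ γ) c) ≠ 0 := by
    rw [key, hfun, a2]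
    have := det2_map_aux (fderiv ℝ Φ (γ c) : (ℝ × ℝ) →ₗ[ℝ] ℝ × ℝ) (iteratedDeriv 2 γ c)
      (iteratedDeriv 7 γ c - (7 * k) • iteratedDeriv 6 γ c
      - (7 * l - (70 / 3 : ℝ) * k ^ 3) • iteratedDeriv 4 γ c)
    exact this ▸ mul_ne_zero hJac h7
  refine ⟨?_, ?_, ?_, ?_, hdet⟩
  · rw [← iteratedDeriv_one]; exact a1
  · intro h
    rw [h] at hdet
    simp [det2] at hdet
  · rw [hfun, a3, a2, h3, map_smul]
  · rw [hfun, a5, a4, a2, h5', h3]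
    simp only [map_add, map_smul, smul_apply]
    module

end
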